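/- arXiv:0907.0062 — 2 statements merged into one kernel-verified Lean document; each statement's English description precedes it below -/
import Mathlib

section
/- For t, x ∈ ℝ define X^{t,x}(s) = −(s − 1)² + x + (t − 1)², the exit time τ(t, x) = inf { s : s ≥ t and X^{t,x}(s) ∉ (−1, 1) } (a real infimum), and the value function V(t, x) = min(τ(t, x), 2) − t. Then for every t ∈ [0, 1), taking x = 2t − t² (so that x + (t − 1)² = 1 and x ∈ [0, 1)), one has τ(t, x) = 1 and hence V(t, x) = 1 − t. -/
/-- The solution path `X^{t,x}(s) = −(s − 1)² + x + (t − 1)²`. -/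
def pathX (t x s : ℝ) : ℝ := -(s - 1) ^ 2 + x + (t - 1) ^ 2

/-- First exit time of `X^{t,x}` from `(−1, 1)` after `t`. -/
noncomputable def exitTime (t x : ℝ) : ℝ :=
  sInf {s : ℝ | t ≤ s ∧ pathX t x s ∉ Set.Ioo (-1 : ℝ) 1}

/-- The value function `V(t, x) = (τ^{t,x} ∧ 2) − t`. -/
noncomputable def valueV (t x : ℝ) : ℝ := min (exitTime t x) 2 - t

/-- On the tangency parabola the path is `1 − (s − 1)²`. -/
theorem pathX_parabola (t s : ℝ) : pathX t (2 * t - t ^ 2) s = 1 - (s - 1) ^ 2 := by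
  unfold pathX
  ring

/-- On the tangency parabola, starting at `t ∈ [0, 1)`, the path leaves `(−1, 1)` at time `1`. -/
theorem exitTime_parabola {t : ℝ} (ht : t ∈ Set.Ico (0 : ℝ) 1) :
    exitTime t (2 * t - t ^ 2) = 1 := by
  refine IsLeast.csInf_eq ⟨⟨ht.2.le, by simp [pathX_parabola]⟩, ?_⟩
  rintro s ⟨hts, hs⟩
  by_contra! hlt
  refine hs ?_
  rw [pathX_parabola]
  constructor <;> nlinarith [ht.1]

/-- On the tangency parabola `x = 2t − t²` (for `t ∈ [0, 1)`) the exit time is `1`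
and the value function equals `1 − t`. -/
theorem value_on_parabola (t : ℝ) (ht : t ∈ Set.Ico (0 : ℝ) 1) :
    exitTime t (2 * t - t ^ 2) = 1 ∧ valueV t (2 * t - t ^ 2) = 1 - t := by
  have h := exitTime_parabola ht
  refine ⟨h, ?_⟩
  rw [valueV, h, min_eq_left one_le_two]
end

section
/- For t, x ∈ ℝ define X^{t,x}(s) = −(s − 1)² + x + (t − 1)², the exit time τ(t, x) = inf { s : s ≥ t and X^{t,x}(s) ∉ (−1, 1) } (a real infimum), and the value function V(t, x) = min(τ(t, x), 2) − t. Then for every t ∈ [0, 1), the function (t, x) ↦ V(t, x) on ℝ² is NOT continuous at the point (t, 2t − t²); indeed V(t, 2t − t²) = 1 − t while V(t, x′) = 2 − t for all x′ < 2t − t² sufficiently close to 2t − t². -/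
/-- Less than one unit below the tangency parabola the path stays in `(-1, 1)` up to time `2`. -/
theorem two_le_exitTime_of_lt_parabola {t x : ℝ} (ht : t ∈ Set.Ico (0 : ℝ) 1)
    (hx : x < 2 * t - t ^ 2) (hx' : 2 * t - t ^ 2 - 1 < x) : 2 ≤ exitTime t x := by
  obtain ⟨h0, h1⟩ := ht
  refine le_csInf ⟨3, by linarith, fun h => ?_⟩ fun s hs => ?_
  · have := h.1
    unfold pathX at this
    nlinarith
  · obtain ⟨hts, hs⟩ := hs
    by_contra! hlt
    refine hs ⟨?_, ?_⟩ <;> unfold pathX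
    · nlinarith [mul_nonneg (h0.trans hts) (sub_nonneg.2 hlt.le)]
    · nlinarith [sq_nonneg (s - 1)]

/-- The value function is discontinuous at every point of the tangency parabola
`x = 2t − t²`, `t ∈ [0, 1)`: there `V = 1 − t`, while `V = 2 − t` at all points
just below the parabola. -/
theorem value_discontinuous_on_parabola (t : ℝ) (ht : t ∈ Set.Ico (0 : ℝ) 1) :
    ¬ ContinuousAt (fun p : ℝ × ℝ => valueV p.1 p.2) (t, 2 * t - t ^ 2) ∧
      valueV t (2 * t - t ^ 2) = 1 - t ∧
      ∃ δ > 0, ∀ x' : ℝ, x' < 2 * t - t ^ 2 → 2 * t - t ^ 2 - δ < x' →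
        valueV t x' = 2 - t := by
  have hon : valueV t (2 * t - t ^ 2) = 1 - t := by
    rw [valueV, exitTime_parabola ht, min_eq_left one_le_two]
  have hbelow : ∀ x' : ℝ, x' < 2 * t - t ^ 2 → 2 * t - t ^ 2 - 1 < x' →
      valueV t x' = 2 - t := fun x' hx hx' => by
    rw [valueV, min_eq_right (two_le_exitTime_of_lt_parabola ht hx hx')]
  refine ⟨fun hc => ?_, hon, 1, one_pos, hbelow⟩
  have hslice : ContinuousAt (fun x => valueV t x) (2 * t - t ^ 2) :=
    ContinuousAt.comp (f := fun x : ℝ => (t, x)) hc (by fun_prop)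
  have hlim := hslice.tendsto.mono_left (nhdsWithin_le_nhds (s := Set.Iio (2 * t - t ^ 2)))
  have hev : (fun x => valueV t x) =ᶠ[nhdsWithin (2 * t - t ^ 2) (Set.Iio (2 * t - t ^ 2))]
      fun _ => 2 - t := by
    filter_upwards [Ioo_mem_nhdsLT (sub_one_lt (2 * t - t ^ 2))] with x hx
    exact hbelow x hx.2 hx.1
  have := tendsto_nhds_unique (hlim.congr' hev) tendsto_const_nhds
  linarith
end
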